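/- For every real t > 0 with t not an integer multiple causing a vanishing denominator, and every real z with 0 ≤ z < 1, the hypergeometric series Σ_{n≥0} [((t−2)/2)ₙ ((t+1)/2)ₙ / ((t)ₙ n!)] · zⁿ equals (2^t/(2t))·(t−1+√(1−z))·(1+√(1−z))^{1−t}. -/

import Mathlib

/-- The rising Pochhammer symbol `(a)ₙ = a(a+1)⋯(a+n−1)`. -/
noncomputable def poch (a : ℝ) (n : ℕ) : ℝ := ∏ i ∈ Finset.range n, (a + i)

open Complex in
lemma ode_step (g : ℂ → ℂ) (hg : DifferentiableOn ℂ g (Metric.ball 0 1)) (a b c : ℂ)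
    (hode : ∀ z ∈ Metric.ball (0:ℂ) 1, z * (1 - z) * iteratedDeriv 2 g z
      + (c - (a + b + 1) * z) * iteratedDeriv 1 g z - a * b * iteratedDeriv 0 g z = 0) (n : ℕ) :
    ∀ z ∈ Metric.ball (0:ℂ) 1, z * (1 - z) * iteratedDeriv (n+2) g z
      + (c + n - (a + b + 1 + 2 * n) * z) * iteratedDeriv (n+1) g z
      - (a + n) * (b + n) * iteratedDeriv n g z = 0 := by
  have hd : ∀ (m : ℕ), ∀ z ∈ Metric.ball (0:ℂ) 1,
      HasDerivAt (iteratedDeriv m g) (iteratedDeriv (m+1) g z) z := by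
    intro m z hz
    have han : AnalyticAt ℂ g z := hg.analyticAt (Metric.isOpen_ball.mem_nhds hz)
    have h2 : AnalyticAt ℂ (iteratedDeriv m g) z := by
      rw [iteratedDeriv_eq_iterate]
      exact han.iterated_deriv m
    rw [iteratedDeriv_succ]
    exact h2.differentiableAt.hasDerivAt
  induction n with
  | zero => simpa using hode
  | succ n ih =>
    intro z hz
    have h1 := ((((hasDerivAt_id z).mul ((hasDerivAt_const z (1:ℂ)).sub (hasDerivAt_id z))).mul
      (hd (n+2) z hz)).add (((hasDerivAt_const z (c + n)).sub
      ((hasDerivAt_id z).const_mul (a + b + 1 + 2 * n))).mul (hd (n+1) z hz))).sub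
      ((hd n z hz).const_mul ((a + n) * (b + n)))
    have h2 : HasDerivAt (fun _ : ℂ => (0:ℂ)) 0 z := hasDerivAt_const z 0
    have h3 := h2.congr_of_eventuallyEq (f₁ := fun z => z * (1 - z) * iteratedDeriv (n+2) g z
      + (c + n - (a + b + 1 + 2 * n) * z) * iteratedDeriv (n+1) g z
      - (a + n) * (b + n) * iteratedDeriv n g z)
      (Filter.eventuallyEq_of_mem (Metric.isOpen_ball.mem_nhds hz) ih)
    have h4 := h1.unique h3
    simp only [id, Pi.mul_apply, Pi.sub_apply] at h4
    push_cast
    rw [← h4]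
    ring_nf

lemma coeff (g : ℂ → ℂ) (hg : DifferentiableOn ℂ g (Metric.ball 0 1)) (a b c : ℝ) (hc : 0 < c)
    (h0 : g 0 = 1)
    (hode : ∀ z ∈ Metric.ball (0:ℂ) 1, z * (1 - z) * iteratedDeriv 2 g z
      + (c - (a + b + 1) * z) * iteratedDeriv 1 g z - a * b * iteratedDeriv 0 g z = 0) (n : ℕ) :
    iteratedDeriv n g 0 = ((poch a n * poch b n / poch c n : ℝ) : ℂ) := by
  induction n with
  | zero => simp [poch, h0]
  | succ n ih =>
    have h := ode_step g hg a b c hode n 0 (by simp)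
    have hp : poch c n ≠ 0 := by
      unfold poch
      exact Finset.prod_ne_zero_iff.mpr (fun i _ => by positivity)
    have hcn : (c + n : ℝ) ≠ 0 := by positivity
    have e : ∀ x, poch x (n+1) = poch x n * (x + n) := fun x => Finset.prod_range_succ _ _
    rw [ih] at h
    have hcn' : (c + n : ℂ) ≠ 0 := by exact_mod_cast hcn
    have hp' : (poch c n : ℂ) ≠ 0 := by exact_mod_cast hp
    apply mul_left_cancel₀ hcn'
    rw [e, e, e]
    push_cast at h ⊢
    field_simp at h ⊢
    linear_combination h

noncomputable def sqz (z : ℂ) : ℂ := Complex.exp (Complex.log (1 - z) / 2)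

noncomputable def gg (t : ℝ) (z : ℂ) : ℂ := ((2 : ℝ) ^ t / (2 * t) : ℝ) * (t - 1 + sqz z) *
  ((1 + sqz z) * Complex.exp (-t * Complex.log (1 + sqz z)))

lemma one_sub_mem {z : ℂ} (hz : z ∈ Metric.ball (0:ℂ) 1) : 1 - z ∈ Complex.slitPlane := by
  left
  have h : ‖z‖ < 1 := by simpa using hz
  have := (Complex.re_le_norm z)
  simp; linarith

lemma sqz_sq {z : ℂ} (hz : z ∈ Metric.ball (0:ℂ) 1) : sqz z ^ 2 = 1 - z := by
  unfold sqz
  rw [← Complex.exp_nat_mul, show ((2:ℕ):ℂ) * (Complex.log (1 - z) / 2) = Complex.log (1-z) by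
    push_cast; ring]
  exact Complex.exp_log (Complex.slitPlane_ne_zero (one_sub_mem hz))

lemma sqz_re {z : ℂ} (hz : z ∈ Metric.ball (0:ℂ) 1) : 0 < (sqz z).re := by
  unfold sqz
  have h1 := Complex.neg_pi_lt_arg (1 - z)
  have h2 := lt_of_le_of_ne (Complex.arg_le_pi (1 - z))
    (Complex.mem_slitPlane_iff_arg.mp (one_sub_mem hz)).1
  rw [Complex.exp_re]
  have h3 : (Complex.log (1 - z) / 2).im = Complex.arg (1 - z) / 2 := by
    rw [← Complex.log_im]
    simp
  rw [h3]
  exact mul_pos (Real.exp_pos _) (Real.cos_pos_of_mem_Ioo ⟨by linarith, by linarith⟩)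

lemma sqz_deriv {z : ℂ} (hz : z ∈ Metric.ball (0:ℂ) 1) :
    HasDerivAt sqz (-1 / (2 * sqz z)) z := by
  have h := ((((hasDerivAt_id z).const_sub 1).clog (one_sub_mem hz)).div_const 2).cexp
  have hs : sqz z ≠ 0 := Complex.exp_ne_zero _
  refine h.congr_deriv ?_
  change sqz z * _ = _
  simp only [id]
  rw [← sqz_sq hz]
  field_simp

noncomputable def pp (t : ℝ) (z : ℂ) : ℂ := Complex.exp (-t * Complex.log (1 + sqz z))

lemma one_add_mem {z : ℂ} (hz : z ∈ Metric.ball (0:ℂ) 1) : 1 + sqz z ∈ Complex.slitPlane := by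
  left
  have := sqz_re hz
  simp; linarith

lemma pp_deriv (t : ℝ) {z : ℂ} (hz : z ∈ Metric.ball (0:ℂ) 1) :
    HasDerivAt (pp t) (pp t z * (t / (2 * sqz z * (1 + sqz z)))) z := by
  have h := ((((sqz_deriv hz).const_add 1).clog (one_add_mem hz)).const_mul (-t : ℂ)).cexp
  have hs : sqz z ≠ 0 := Complex.exp_ne_zero _
  have hs1 := Complex.slitPlane_ne_zero (one_add_mem hz)
  refine h.congr_deriv ?_
  change pp t z * _ = _
  field_simp

lemma gg_deriv (t : ℝ) {z : ℂ} (hz : z ∈ Metric.ball (0:ℂ) 1) :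
    HasDerivAt (gg t) (((2 : ℝ) ^ t / (2 * t) : ℝ) *
      ((t - 2) * (sqz z + t) * pp t z / (2 * sqz z))) z := by
  have h := (((sqz_deriv hz).const_add (t - 1 : ℂ)).const_mul (((2 : ℝ) ^ t / (2 * t) : ℝ) : ℂ)).mul
    (((sqz_deriv hz).const_add 1).mul (pp_deriv t hz))
  have hs : sqz z ≠ 0 := Complex.exp_ne_zero _
  have hs1 := Complex.slitPlane_ne_zero (one_add_mem hz)
  refine h.congr_deriv ?_
  generalize (((2 : ℝ) ^ t / (2 * t) : ℝ) : ℂ) = K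
  simp only [Pi.mul_apply]
  field_simp
  ring

lemma gg_deriv2 (t : ℝ) {z : ℂ} (hz : z ∈ Metric.ball (0:ℂ) 1) :
    HasDerivAt (deriv (gg t)) (((2 : ℝ) ^ t / (2 * t) : ℝ) *
      ((t - 2) * pp t z / 4 * (t / sqz z ^ 3 + t * (sqz z + t) / (sqz z ^ 2 * (1 + sqz z))))) z := by
  have hs : sqz z ≠ 0 := Complex.exp_ne_zero _
  have hs1 := Complex.slitPlane_ne_zero (one_add_mem hz)
  have h := (((((sqz_deriv hz).add_const (t : ℂ)).const_mul (t - 2 : ℂ)).mul (pp_deriv t hz)).div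
    ((sqz_deriv hz).const_mul 2) (by simpa using hs)).const_mul (((2 : ℝ) ^ t / (2 * t) : ℝ) : ℂ)
  have h' := h.congr_of_eventuallyEq (f₁ := deriv (gg t))
    (Filter.eventuallyEq_of_mem (Metric.isOpen_ball.mem_nhds hz)
      (fun w hw => (gg_deriv t hw).deriv))
  refine h'.congr_deriv ?_
  generalize (((2 : ℝ) ^ t / (2 * t) : ℝ) : ℂ) = K
  simp only [Pi.mul_apply]
  field_simp
  ring

lemma gg_ode (t : ℝ) : ∀ z ∈ Metric.ball (0:ℂ) 1, z * (1 - z) * iteratedDeriv 2 (gg t) z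
      + ((t:ℝ) - ((((t-2)/2 : ℝ) : ℂ) + ((t+1)/2 : ℝ) + 1) * z) * iteratedDeriv 1 (gg t) z
      - ((t-2)/2 : ℝ) * ((t+1)/2 : ℝ) * iteratedDeriv 0 (gg t) z = 0 := by
  intro z hz
  have hs : sqz z ≠ 0 := Complex.exp_ne_zero _
  have hs1 := Complex.slitPlane_ne_zero (one_add_mem hz)
  have hz' : z = 1 - sqz z ^ 2 := by rw [sqz_sq hz]; ring
  rw [iteratedDeriv_succ, iteratedDeriv_one, iteratedDeriv_zero, (gg_deriv2 t hz).deriv,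
    (gg_deriv t hz).deriv]
  have hg : gg t z = ((2 : ℝ) ^ t / (2 * t) : ℝ) * (t - 1 + sqz z) * ((1 + sqz z) * pp t z) := rfl
  rw [hg]
  generalize (((2 : ℝ) ^ t / (2 * t) : ℝ) : ℂ) = K
  generalize pp t z = P
  generalize sqz z = s at *
  subst hz'
  push_cast
  field_simp
  ring

lemma sqz_real (z : ℝ) (hz1 : z < 1) : sqz z = (Real.sqrt (1 - z) : ℝ) := by
  unfold sqz
  rw [show (1 - (z:ℂ)) = ((1 - z : ℝ) : ℂ) by push_cast; rfl, ← Complex.ofReal_log (by linarith),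
    show ((Real.log (1 - z) : ℝ) : ℂ) / 2 = ((Real.log (1 - z) / 2 : ℝ) : ℂ) by push_cast; rfl,
    ← Complex.ofReal_exp, Real.exp_half, Real.exp_log (by linarith)]

lemma gg_real (t z : ℝ) (hz1 : z < 1) : gg t z = ((2 : ℝ) ^ t / (2 * t) *
    (t - 1 + Real.sqrt (1 - z)) * (1 + Real.sqrt (1 - z)) ^ (1 - t) : ℝ) := by
  unfold gg
  have hp : 0 < 1 + Real.sqrt (1 - z) := by positivity
  rw [sqz_real z hz1, show (1 - t) = 1 + -t by ring, Real.rpow_add hp, Real.rpow_one,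
    Real.rpow_def_of_pos hp (-t),
    show (1 + ((Real.sqrt (1 - z) : ℝ) : ℂ)) = ((1 + Real.sqrt (1 - z) : ℝ) : ℂ) by push_cast; rfl,
    ← Complex.ofReal_log hp.le]
  push_cast
  rw [mul_comm (-(t:ℂ))]

theorem stmt_12 (t : ℝ) (ht : 0 < t) (z : ℝ) (hz0 : 0 ≤ z) (hz1 : z < 1) :
    HasSum
      (fun n : ℕ =>
        poch ((t - 2) / 2) n * poch ((t + 1) / 2) n / (poch t n * n.factorial) * z ^ n)
      ((2 : ℝ) ^ t / (2 * t) * (t - 1 + Real.sqrt (1 - z)) *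
        (1 + Real.sqrt (1 - z)) ^ (1 - t)) := by
  have hd : DifferentiableOn ℂ (gg t) (Metric.ball 0 1) := fun w hw =>
    (gg_deriv t hw).differentiableAt.differentiableWithinAt
  have h0 : gg t 0 = 1 := by
    have := gg_real t 0 one_pos
    rw [Complex.ofReal_zero] at this
    rw [this, sub_zero, Real.sqrt_one, show (1 + 1 : ℝ) = 2 by norm_num,
      Real.rpow_sub two_pos, Real.rpow_one]
    have h2 : (2:ℝ) ^ t ≠ 0 := (Real.rpow_pos_of_pos two_pos t).ne'
    rw [← Complex.ofReal_one]
    congr 1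
    field_simp
    ring
  have hzb : (z : ℂ) ∈ Metric.ball (0:ℂ) 1 := by
    simp [abs_of_nonneg hz0, hz1]
  have h := Complex.hasSum_taylorSeries_on_ball hd hzb
  rw [gg_real t z hz1] at h
  rw [← Complex.hasSum_ofReal]
  suffices key : (fun n : ℕ => ((poch ((t - 2) / 2) n * poch ((t + 1) / 2) n /
      (poch t n * n.factorial) * z ^ n : ℝ) : ℂ)) =
      fun n : ℕ => ((n.factorial : ℂ)⁻¹) • ((z : ℂ) - 0) ^ n • iteratedDeriv n (gg t) 0 by
    rw [key]
    exact h
  funext n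
  rw [coeff (gg t) hd ((t-2)/2) ((t+1)/2) t ht h0 (gg_ode t) n]
  simp only [smul_eq_mul, sub_zero]
  push_cast
  simp only [div_eq_mul_inv, mul_inv]
  ring
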